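/- arXiv:1611.03023 — 2 statements merged into one kernel-verified Lean document; each statement's English description precedes it below -/
import Mathlib

section
/- Under the stated assumptions (D1)–(D3) and (C), let (α(ω), x(ω)) be the ℱ₁-measurable/ℱ₀-measurable pair guaranteed by the existence part of the theorem (α(ω) > 0, x(ω) ∈ K°(ω), ⟨φ(ω), x(ω)⟩ = 1, and α(ω)x(Tω) = D(ω)x(ω) a.s.). Then, for P-almost every ω, sup over all nonzero a ∈ K₋ₜ(ω) of ‖ C(t, T^{−t}ω)a / ⟨φ(ω), C(t, T^{−t}ω)a⟩ − x(ω) ‖ tends to 0 as t → ∞; that is, the normalized cocycle iterates C(t, T^{−t}ω)a/⟨φ(ω), C(t, T^{−t}ω)a⟩ converge to x(ω) uniformly in 0 ≠ a ∈ K₋ₜ(ω), almost surely. -/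
open MeasureTheory Filter Topology
open scoped ENNReal Classical

noncomputable section

/-- A cone: a set containing all nonnegative linear combinations of its elements. -/
def IsCone {E : Type*} [AddCommGroup E] [Module ℝ E] (K : Set E) : Prop :=
  ∀ x ∈ K, ∀ y ∈ K, ∀ a b : ℝ, 0 ≤ a → 0 ≤ b → a • x + b • y ∈ K

/-- A solid cone: a closed proper cone with nonempty interior. -/
def IsSolidCone {E : Type*} [NormedAddCommGroup E] [NormedSpace ℝ E] (K : Set E) : Prop :=
  IsCone K ∧ IsClosed K ∧ K ∩ (-K) = {0} ∧ (interior K).Nonempty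

/-- `x ≤_K y` iff `y - x ∈ K`. -/
def coneLE {E : Type*} [AddCommGroup E] (K : Set E) (x y : E) : Prop := y - x ∈ K

/-- `x ≺_K y` iff `x ≤_K y` and `x ≠ y`. -/
def conePrec {E : Type*} [AddCommGroup E] (K : Set E) (x y : E) : Prop :=
  coneLE K x y ∧ x ≠ y

/-- `x <_K y` iff `y - x ∈ K°`. -/
def coneLT {E : Type*} [NormedAddCommGroup E] (K : Set E) (x y : E) : Prop :=
  y - x ∈ interior K

/-- A map `D : K → L` is completely monotone if it preserves each of the three
order relations `≤_K`, `≺_K`, `<_K`. -/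
def CompletelyMonotoneOn {E : Type*} [NormedAddCommGroup E] (K L : Set E) (D : E → E) : Prop :=
  (∀ x ∈ K, ∀ y ∈ K, coneLE K x y → coneLE L (D x) (D y)) ∧
  (∀ x ∈ K, ∀ y ∈ K, conePrec K x y → conePrec L (D x) (D y)) ∧
  (∀ x ∈ K, ∀ y ∈ K, coneLT K x y → coneLT L (D x) (D y))

/-- A map `D : K → L` is strictly monotone if `x ≺_K y` implies `D x <_L D y`. -/
def ConeStrictlyMonotoneOn {E : Type*} [NormedAddCommGroup E] (K L : Set E) (D : E → E) : Prop :=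
  ∀ x ∈ K, ∀ y ∈ K, conePrec K x y → coneLT L (D x) (D y)

/-- The dual cone `K* = {φ : φ(x) ≥ 0 for all x ∈ K}`. -/
def dualCone {E : Type*} [NormedAddCommGroup E] [NormedSpace ℝ E] (K : Set E) :
    Set (E →L[ℝ] ℝ) := {φ | ∀ x ∈ K, 0 ≤ φ x}

section OrderGauge

variable {E : Type*} [NormedAddCommGroup E] [NormedSpace ℝ E]

/-- A solid cone `K` with an interior point `x` and an interior dual functional `φ` such that
`φ x = 1`. -/
structure IsUnitPair (K : Set E) (x : E) (φ : E →L[ℝ] ℝ) : Prop where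
  solid : IsSolidCone K
  mem_interior : x ∈ interior K
  dual_mem : φ ∈ interior (dualCone K)
  apply_eq_one : φ x = 1

/-- The least `s` such that `b ≤_K s • x`. -/
def orderGauge (K : Set E) (x b : E) : ℝ := sInf {s : ℝ | s • x - b ∈ K}

/-- The ratio `m / M` of the optimal constants in `m • x ≤_K b ≤_K M • x`. -/
def orderRatio (K : Set E) (x b : E) : ℝ := -orderGauge K x (-b) / orderGauge K x b

namespace IsSolidCone

variable {K : Set E}

lemma add_mem (hK : IsSolidCone K) {a b : E} (ha : a ∈ K) (hb : b ∈ K) : a + b ∈ K := by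
  simpa using hK.1 a ha b hb 1 1 zero_le_one zero_le_one

lemma smul_mem (hK : IsSolidCone K) {c : ℝ} (hc : 0 ≤ c) {a : E} (ha : a ∈ K) : c • a ∈ K := by
  simpa using hK.1 a ha a ha c 0 hc le_rfl

lemma zero_mem (hK : IsSolidCone K) : (0 : E) ∈ K := by
  have h : (0 : E) ∈ K ∩ -K := by rw [hK.2.2.1]; rfl
  exact h.1

lemma convex (hK : IsSolidCone K) : Convex ℝ K :=
  fun a ha b hb s t hs ht _ => hK.1 a ha b hb s t hs ht

lemma mem_closure_inter_of_dense (hK : IsSolidCone K) {Q : Set E} (hQ : Dense Q) {a : E}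
    (ha : a ∈ K) : a ∈ closure (K ∩ Q) := by
  have h1 : a ∈ closure (interior K) := by
    rw [hK.convex.closure_interior_eq_closure_of_nonempty_interior hK.2.2.2]
    exact subset_closure ha
  have h2 := hQ.open_subset_closure_inter (isOpen_interior (s := K))
  have h3 : closure (interior K) ⊆ closure (K ∩ Q) := by
    apply closure_minimal _ isClosed_closure
    exact h2.trans (closure_mono (Set.inter_subset_inter_left _ interior_subset))
  exact h3 h1

end IsSolidCone

/-- A functional in the interior of the dual cone is coercive on the cone. -/
lemma exists_mul_norm_le_of_mem_interior_dualCone {K : Set E} {φ : E →L[ℝ] ℝ}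
    (hφ : φ ∈ interior (dualCone K)) : ∃ c > 0, ∀ y ∈ K, c * ‖y‖ ≤ φ y := by
  rw [mem_interior_iff_mem_nhds, Metric.mem_nhds_iff] at hφ
  obtain ⟨r, hr, hball⟩ := hφ
  refine ⟨r / 2, by positivity, fun y hy => ?_⟩
  obtain ⟨g, hg, hgy⟩ := exists_dual_vector'' ℝ y
  have hmem : φ - (r / 2) • g ∈ dualCone K := by
    apply hball
    rw [Metric.mem_ball, dist_eq_norm, sub_sub_cancel_left, norm_neg, norm_smul,
      Real.norm_of_nonneg (by positivity)]
    nlinarith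
  have h := hmem y hy
  simp only [sub_apply, smul_apply, smul_eq_mul] at h
  rw [hgy] at h
  simpa using h

namespace IsUnitPair

variable {K : Set E} {x : E} {φ : E →L[ℝ] ℝ}

lemma apply_nonneg (h : IsUnitPair K x φ) {y : E} (hy : y ∈ K) : 0 ≤ φ y :=
  interior_subset h.dual_mem y hy

lemma apply_pos (h : IsUnitPair K x φ) {y : E} (hy : y ∈ K) (hy0 : y ≠ 0) : 0 < φ y := by
  obtain ⟨c, hc, hcK⟩ := exists_mul_norm_le_of_mem_interior_dualCone h.dual_mem
  exact (mul_pos hc (norm_pos_iff.2 hy0)).trans_le (hcK y hy)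

lemma mem (h : IsUnitPair K x φ) : x ∈ K := interior_subset h.mem_interior

lemma ne_zero (h : IsUnitPair K x φ) : x ≠ 0 := by
  rintro rfl
  simpa using h.apply_eq_one

lemma exists_smul_sub_mem (h : IsUnitPair K x φ) :
    ∃ c > 0, ∀ b : E, (c * ‖b‖) • x - b ∈ K := by
  have hx := h.mem_interior
  rw [mem_interior_iff_mem_nhds, Metric.mem_nhds_iff] at hx
  obtain ⟨r, hr, hball⟩ := hx
  refine ⟨2 / r, by positivity, fun b => ?_⟩
  rcases eq_or_ne b 0 with rfl | hb
  · simpa using h.solid.zero_mem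
  have hb' : 0 < ‖b‖ := norm_pos_iff.2 hb
  have hc : 0 < 2 / r * ‖b‖ := by positivity
  have hm : x - (2 / r * ‖b‖)⁻¹ • b ∈ K := by
    apply hball
    rw [Metric.mem_ball, dist_eq_norm, sub_sub_cancel_left, norm_neg, norm_smul,
      Real.norm_of_nonneg (by positivity)]
    field_simp
    linarith
  have := h.solid.smul_mem hc.le hm
  rwa [smul_sub, smul_inv_smul₀ hc.ne'] at this

lemma apply_le_of_smul_sub_mem (h : IsUnitPair K x φ) {s : ℝ} {b : E} (hs : s • x - b ∈ K) :
    φ b ≤ s := by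
  have := h.apply_nonneg hs
  simp only [map_sub, map_smul, h.apply_eq_one, smul_eq_mul] at this
  linarith

lemma bddBelow (h : IsUnitPair K x φ) (b : E) : BddBelow {s : ℝ | s • x - b ∈ K} :=
  ⟨φ b, fun _ hs => h.apply_le_of_smul_sub_mem hs⟩

lemma orderGauge_smul_sub_mem (h : IsUnitPair K x φ) (b : E) : orderGauge K x b • x - b ∈ K := by
  obtain ⟨c, -, hc⟩ := h.exists_smul_sub_mem
  have hcl : IsClosed {s : ℝ | s • x - b ∈ K} :=
    h.solid.2.1.preimage (f := fun s : ℝ => s • x - b) (by fun_prop)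
  exact hcl.csInf_mem ⟨_, hc b⟩ (h.bddBelow b)

lemma orderGauge_le_iff (h : IsUnitPair K x φ) {b : E} {s : ℝ} :
    orderGauge K x b ≤ s ↔ s • x - b ∈ K := by
  refine ⟨fun hs => ?_, fun hs => csInf_le (h.bddBelow b) hs⟩
  have := h.solid.add_mem (h.solid.smul_mem (sub_nonneg.2 hs) h.mem) (h.orderGauge_smul_sub_mem b)
  convert this using 1
  module

lemma apply_le_orderGauge (h : IsUnitPair K x φ) (b : E) : φ b ≤ orderGauge K x b :=
  h.apply_le_of_smul_sub_mem (h.orderGauge_smul_sub_mem b)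

lemma orderGauge_lt (h : IsUnitPair K x φ) {b : E} {s : ℝ} (hs : s • x - b ∈ interior K) :
    orderGauge K x b < s := by
  have hcont : Continuous fun u : ℝ => u • x - b := by fun_prop
  have hev : ∀ᶠ u in 𝓝 s, u • x - b ∈ interior K :=
    hcont.continuousAt.eventually_mem (isOpen_interior.mem_nhds hs)
  obtain ⟨u, hu, hus⟩ := ((hev.filter_mono nhdsWithin_le_nhds).and
    (self_mem_nhdsWithin (a := s) (s := Set.Iio s))).exists
  exact (h.orderGauge_le_iff.2 (interior_subset hu)).trans_lt hus

lemma orderGauge_add_le (h : IsUnitPair K x φ) (a b : E) :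
    orderGauge K x (a + b) ≤ orderGauge K x a + orderGauge K x b := by
  rw [h.orderGauge_le_iff]
  convert h.solid.add_mem (h.orderGauge_smul_sub_mem a) (h.orderGauge_smul_sub_mem b) using 1
  module

lemma orderGauge_smul (h : IsUnitPair K x φ) {c : ℝ} (hc : 0 < c) (b : E) :
    orderGauge K x (c • b) = c * orderGauge K x b := by
  apply le_antisymm
  · rw [h.orderGauge_le_iff]
    convert h.solid.smul_mem hc.le (h.orderGauge_smul_sub_mem b) using 1
    module
  · rw [← le_inv_mul_iff₀ hc, h.orderGauge_le_iff]
    convert h.solid.smul_mem (inv_pos.2 hc).le (h.orderGauge_smul_sub_mem (c • b)) using 1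
    rw [smul_sub, inv_smul_smul₀ hc.ne', mul_smul]

lemma continuous_orderGauge (h : IsUnitPair K x φ) : Continuous (orderGauge K x) := by
  obtain ⟨c, hc, hcK⟩ := h.exists_smul_sub_mem
  refine (LipschitzWith.of_le_add_mul ⟨c, hc.le⟩ fun a b => ?_).continuous
  have h1 := h.orderGauge_add_le b (a - b)
  rw [add_sub_cancel] at h1
  have h2 := h.orderGauge_le_iff.2 (hcK (a - b))
  rw [dist_eq_norm]
  exact h1.trans (add_le_add_right h2 _)

lemma orderGauge_smul_self (h : IsUnitPair K x φ) (s : ℝ) : orderGauge K x (s • x) = s := by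
  apply le_antisymm
  · rw [h.orderGauge_le_iff, sub_self]
    exact h.solid.zero_mem
  · simpa [h.apply_eq_one] using h.apply_le_orderGauge (s • x)

lemma orderGauge_pos (h : IsUnitPair K x φ) {b : E} (hb : b ∈ K) (hb0 : b ≠ 0) :
    0 < orderGauge K x b :=
  (h.apply_pos hb hb0).trans_le (h.apply_le_orderGauge b)

lemma neg_orderGauge_neg_nonneg (h : IsUnitPair K x φ) {b : E} (hb : b ∈ K) :
    0 ≤ -orderGauge K x (-b) := by
  rw [neg_nonneg, h.orderGauge_le_iff]
  simpa using hb

lemma sub_neg_orderGauge_neg_smul_mem (h : IsUnitPair K x φ) (b : E) :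
    b - (-orderGauge K x (-b)) • x ∈ K := by
  convert h.orderGauge_smul_sub_mem (-b) using 1
  module

lemma neg_orderGauge_neg_le_apply (h : IsUnitPair K x φ) (b : E) :
    -orderGauge K x (-b) ≤ φ b := by
  have := h.apply_le_orderGauge (-b)
  rw [map_neg] at this
  linarith

lemma orderRatio_le_one (h : IsUnitPair K x φ) {b : E} (hb : b ∈ K) (hb0 : b ≠ 0) :
    orderRatio K x b ≤ 1 := by
  rw [orderRatio, div_le_one (h.orderGauge_pos hb hb0)]
  exact (h.neg_orderGauge_neg_le_apply b).trans (h.apply_le_orderGauge b)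

lemma orderRatio_nonneg (h : IsUnitPair K x φ) {b : E} (hb : b ∈ K) (hb0 : b ≠ 0) :
    0 ≤ orderRatio K x b :=
  div_nonneg (h.neg_orderGauge_neg_nonneg hb) (h.orderGauge_pos hb hb0).le

lemma orderRatio_smul (h : IsUnitPair K x φ) {c : ℝ} (hc : 0 < c) (b : E) :
    orderRatio K x (c • b) = orderRatio K x b := by
  rw [orderRatio, ← smul_neg, h.orderGauge_smul hc, h.orderGauge_smul hc, ← mul_neg,
    mul_div_mul_left _ _ hc.ne', orderRatio]

lemma orderRatio_smul_self (h : IsUnitPair K x φ) {s : ℝ} (hs : s ≠ 0) :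
    orderRatio K x (s • x) = 1 := by
  rw [orderRatio, ← neg_smul, h.orderGauge_smul_self, h.orderGauge_smul_self, neg_neg, div_self hs]

lemma continuousAt_orderRatio (h : IsUnitPair K x φ) {b : E} (hb : b ∈ K) (hb0 : b ≠ 0) :
    ContinuousAt (orderRatio K x) b := by
  have hc := h.continuous_orderGauge
  exact (hc.comp continuous_neg).neg.continuousAt.div hc.continuousAt
    (h.orderGauge_pos hb hb0).ne'

/-- If the ratio of `b` is close to one, then `b`, normalized by `φ`, is close to `x`. -/
lemma exists_norm_normalized_sub_le (h : IsUnitPair K x φ) :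
    ∃ c > 0, ∀ b ∈ K, b ≠ 0 → ‖(φ b)⁻¹ • b - x‖ ≤ c * (1 - orderRatio K x b) := by
  obtain ⟨c, hc, hcK⟩ := exists_mul_norm_le_of_mem_interior_dualCone h.dual_mem
  refine ⟨c⁻¹ + ‖x‖, by positivity, fun b hb hb0 => ?_⟩
  have hpos := h.apply_pos hb hb0
  rw [← h.orderRatio_smul (inv_pos.2 hpos) b]
  have hy : (φ b)⁻¹ • b ∈ K := h.solid.smul_mem (inv_pos.2 hpos).le hb
  have hy0 : (φ b)⁻¹ • b ≠ 0 := smul_ne_zero (inv_pos.2 hpos).ne' hb0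
  have hφy : φ ((φ b)⁻¹ • b) = 1 := by simp [hpos.ne']
  generalize (φ b)⁻¹ • b = y at hy hy0 hφy
  set m := -orderGauge K x (-y) with hm
  have hM : 1 ≤ orderGauge K x y := hφy ▸ h.apply_le_orderGauge y
  have hm1 : m ≤ 1 := hφy ▸ h.neg_orderGauge_neg_le_apply y
  have hm0 : 0 ≤ m := h.neg_orderGauge_neg_nonneg hy
  have hratio : orderRatio K x y ≤ m := div_le_self hm0 hM
  have h1 := hcK _ (h.sub_neg_orderGauge_neg_smul_mem y)
  rw [← hm, map_sub, map_smul, hφy, h.apply_eq_one, smul_eq_mul, mul_one] at h1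
  have h2 : ‖y - m • x‖ ≤ c⁻¹ * (1 - m) := by
    rwa [le_inv_mul_iff₀ hc]
  calc ‖y - x‖ = ‖(y - m • x) - (1 - m) • x‖ := by congr 1; module
    _ ≤ ‖y - m • x‖ + ‖(1 - m) • x‖ := norm_sub_le _ _
    _ ≤ c⁻¹ * (1 - m) + (1 - m) * ‖x‖ := by
        rw [norm_smul, Real.norm_of_nonneg (sub_nonneg.2 hm1)]
        exact add_le_add_left h2 _
    _ = (c⁻¹ + ‖x‖) * (1 - m) := by ring
    _ ≤ _ := by gcongr

lemma isCompact_slice [FiniteDimensional ℝ E] (h : IsUnitPair K x φ) :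
    IsCompact {y ∈ K | φ y = 1} := by
  obtain ⟨c, hc, hcK⟩ := exists_mul_norm_le_of_mem_interior_dualCone h.dual_mem
  refine Metric.isCompact_of_isClosed_isBounded
    (h.solid.2.1.inter (isClosed_eq φ.continuous continuous_const)) ?_
  refine Metric.isBounded_iff_subset_closedBall 0 |>.2 ⟨c⁻¹, fun y hy => ?_⟩
  rw [mem_closedBall_zero_iff, ← mul_one c⁻¹, le_inv_mul_iff₀ hc, ← hy.2]
  exact hcK y hy.1

end IsUnitPair

/-- A continuous, homogeneous, completely monotone map between cones. -/
structure IsConeMap (K L : Set E) (G : E → E) : Prop where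
  mapsTo : Set.MapsTo G K L
  continuousOn : ContinuousOn G K
  map_smul : ∀ l : ℝ, 0 < l → ∀ x ∈ K, G (l • x) = l • G x
  monotone : CompletelyMonotoneOn K L G

namespace IsConeMap

variable {K L M : Set E} {G H : E → E}

lemma id (K : Set E) : IsConeMap K K id :=
  ⟨Set.mapsTo_id K, continuousOn_id, fun _ _ _ _ => rfl,
    fun _ _ _ _ h => h, fun _ _ _ _ h => h, fun _ _ _ _ h => h⟩

lemma comp (hH : IsConeMap L M H) (hG : IsConeMap K L G) : IsConeMap K M (H ∘ G) where
  mapsTo := hH.mapsTo.comp hG.mapsTo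
  continuousOn := hH.continuousOn.comp hG.continuousOn hG.mapsTo
  map_smul l hl x hx := by
    rw [Function.comp_apply, hG.map_smul l hl x hx, hH.map_smul l hl _ (hG.mapsTo hx)]; rfl
  monotone :=
    ⟨fun x hx y hy h => hH.monotone.1 _ (hG.mapsTo hx) _ (hG.mapsTo hy) (hG.monotone.1 x hx y hy h),
      fun x hx y hy h =>
        hH.monotone.2.1 _ (hG.mapsTo hx) _ (hG.mapsTo hy) (hG.monotone.2.1 x hx y hy h),
      fun x hx y hy h =>
        hH.monotone.2.2 _ (hG.mapsTo hx) _ (hG.mapsTo hy) (hG.monotone.2.2 x hx y hy h)⟩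

lemma map_zero (hG : IsConeMap K L G) (hK : IsSolidCone K) : G 0 = 0 := by
  have h := hG.map_smul 2 two_pos 0 hK.zero_mem
  rw [smul_zero, two_smul] at h
  simpa using h

lemma map_smul_nonneg (hG : IsConeMap K L G) (hK : IsSolidCone K) {l : ℝ} (hl : 0 ≤ l) {x : E}
    (hx : x ∈ K) : G (l • x) = l • G x := by
  rcases hl.eq_or_lt with rfl | hl
  · simp [hG.map_zero hK]
  · exact hG.map_smul l hl x hx

lemma map_ne_zero (hG : IsConeMap K L G) (hK : IsSolidCone K) {a : E} (ha : a ∈ K) (ha0 : a ≠ 0) :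
    G a ≠ 0 := by
  have h := (hG.monotone.2.1 0 hK.zero_mem a ha ⟨by simpa [coneLE] using ha, ha0.symm⟩).2
  rw [hG.map_zero hK] at h
  exact h.symm

variable {x x' : E} {φ φ' : E →L[ℝ] ℝ} {β : ℝ}

lemma orderGauge_map_le (hG : IsConeMap K L G) (hK : IsUnitPair K x φ) (hL : IsUnitPair L x' φ')
    (hβ : G x = β • x') {a : E} (ha : a ∈ K) (ha0 : a ≠ 0) :
    orderGauge L x' (G a) ≤ β * orderGauge K x a := by
  have hp := hK.orderGauge_pos ha ha0
  have := hG.monotone.1 a ha _ (hK.solid.smul_mem hp.le hK.mem) (hK.orderGauge_smul_sub_mem a)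
  rw [coneLE, hG.map_smul _ hp _ hK.mem, hβ, smul_smul, mul_comm] at this
  exact hL.orderGauge_le_iff.2 this

lemma le_neg_orderGauge_neg_map (hG : IsConeMap K L G) (hK : IsUnitPair K x φ)
    (hL : IsUnitPair L x' φ') (hβ : G x = β • x') {a : E} (ha : a ∈ K) :
    β * -orderGauge K x (-a) ≤ -orderGauge L x' (-G a) := by
  have hm := hK.neg_orderGauge_neg_nonneg ha
  have := hG.monotone.1 _ (hK.solid.smul_mem hm hK.mem) a ha (hK.sub_neg_orderGauge_neg_smul_mem a)
  rw [coneLE, hG.map_smul_nonneg hK.solid hm hK.mem, hβ, smul_smul, mul_comm] at this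
  rw [le_neg, hL.orderGauge_le_iff]
  convert this using 1
  module

lemma orderRatio_le_map (hG : IsConeMap K L G) (hK : IsUnitPair K x φ) (hL : IsUnitPair L x' φ')
    (hβ0 : 0 < β) (hβ : G x = β • x') {a : E} (ha : a ∈ K) (ha0 : a ≠ 0) :
    orderRatio K x a ≤ orderRatio L x' (G a) := by
  rw [orderRatio, ← mul_div_mul_left _ _ hβ0.ne', orderRatio]
  exact div_le_div₀ (hL.neg_orderGauge_neg_nonneg (hG.mapsTo ha))
    (hG.le_neg_orderGauge_neg_map hK hL hβ ha)
    (hL.orderGauge_pos (hG.mapsTo ha) (hG.map_ne_zero hK.solid ha ha0))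
    (hG.orderGauge_map_le hK hL hβ ha ha0)

/-- A strictly monotone map strictly increases the ratio to its eigenvector. -/
lemma orderRatio_lt_map_or_eq_one (hG : IsConeMap K L G) (hstrict : ConeStrictlyMonotoneOn K L G)
    (hK : IsUnitPair K x φ) (hL : IsUnitPair L x' φ') (hβ0 : 0 < β) (hβ : G x = β • x')
    {a : E} (ha : a ∈ K) (ha0 : a ≠ 0) :
    orderRatio K x a < orderRatio L x' (G a) ∨ orderRatio L x' (G a) = 1 := by
  have hm := hK.neg_orderGauge_neg_nonneg ha
  have hmem := hK.sub_neg_orderGauge_neg_smul_mem a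
  by_cases heq : (-orderGauge K x (-a)) • x = a
  · right
    have hm0 : -orderGauge K x (-a) ≠ 0 := by
      intro h0
      rw [h0, zero_smul] at heq
      exact ha0 heq.symm
    rw [← heq, hG.map_smul_nonneg hK.solid hm hK.mem, hβ, smul_smul]
    exact hL.orderRatio_smul_self (mul_ne_zero hm0 hβ0.ne')
  · left
    have := hstrict _ (hK.solid.smul_mem hm hK.mem) a ha ⟨hmem, heq⟩
    rw [coneLT, hG.map_smul_nonneg hK.solid hm hK.mem, hβ, smul_smul, mul_comm] at this
    have hlt : orderGauge L x' (-G a) < -(β * -orderGauge K x (-a)) := by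
      apply hL.orderGauge_lt
      convert this using 1
      module
    rw [orderRatio, ← mul_div_mul_left _ _ hβ0.ne', orderRatio]
    exact div_lt_div₀ (lt_neg.1 hlt) (hG.orderGauge_map_le hK hL hβ ha ha0)
      (hL.neg_orderGauge_neg_nonneg (hG.mapsTo ha))
      (hL.orderGauge_pos (hG.mapsTo ha) (hG.map_ne_zero hK.solid ha ha0))

lemma continuousOn_orderRatio (hG : IsConeMap K L G) (hK : IsSolidCone K)
    (hL : IsUnitPair L x' φ') : ContinuousOn (fun a => orderRatio L x' (G a)) {a ∈ K | a ≠ 0} :=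
  fun a ha => (hL.continuousAt_orderRatio (hG.mapsTo ha.1)
    (hG.map_ne_zero hK ha.1 ha.2)).comp_continuousWithinAt
      ((hG.continuousOn a ha.1).mono fun _ h => h.1)

end IsConeMap

end OrderGauge

section Cocycle

variable {Ω E : Type*} [NormedAddCommGroup E] [NormedSpace ℝ E] {T : Ω ≃ Ω} {K : Ω → Set E}
  {D : Ω → E → E} {C : ℕ → Ω → E → E} {x : Ω → E} {φ : Ω → E →L[ℝ] ℝ}

/-- The smallest order ratio with respect to `x ω` over the image of the cocycle started
at time `-t`. -/
def pullbackRatio (T : Ω ≃ Ω) (K : Ω → Set E) (C : ℕ → Ω → E → E) (x : Ω → E) (t : ℕ) (ω : Ω) :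
    ℝ≥0∞ :=
  ⨅ a ∈ {a ∈ K ((⇑T.symm)^[t] ω) | a ≠ 0},
    ENNReal.ofReal (orderRatio (K ω) (x ω) (C t ((⇑T.symm)^[t] ω) a))

lemma iterate_apply_iterate_symm (T : Ω ≃ Ω) (t : ℕ) (ω : Ω) :
    (⇑T)^[t] ((⇑T.symm)^[t] ω) = ω :=
  Function.LeftInverse.iterate T.apply_symm_apply t ω

lemma iterate_symm_apply_iterate (T : Ω ≃ Ω) (t : ℕ) (ω : Ω) :
    (⇑T.symm)^[t] ((⇑T)^[t] ω) = ω :=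
  Function.LeftInverse.iterate T.symm_apply_apply t ω

omit [NormedAddCommGroup E] [NormedSpace ℝ E] in
lemma cocycle_add (hC0 : ∀ ω, C 0 ω = id) (hCrec : ∀ t ω, C (t + 1) ω = D ((⇑T)^[t] ω) ∘ C t ω)
    (t l : ℕ) (ω : Ω) : C (t + l) ω = C l ((⇑T)^[t] ω) ∘ C t ω := by
  induction l with
  | zero => simp [hC0]
  | succ l ih =>
    rw [← add_assoc, hCrec, ih, hCrec, add_comm t l, Function.iterate_add_apply]
    rfl

lemma isConeMap_cocycle (hD : ∀ ω, IsConeMap (K ω) (K (T ω)) (D ω)) (hC0 : ∀ ω, C 0 ω = id)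
    (hCrec : ∀ t ω, C (t + 1) ω = D ((⇑T)^[t] ω) ∘ C t ω) (t : ℕ) (ω : Ω) :
    IsConeMap (K ω) (K ((⇑T)^[t] ω)) (C t ω) := by
  induction t with
  | zero => simpa [hC0] using IsConeMap.id (K ω)
  | succ t ih =>
    rw [hCrec, Function.iterate_succ_apply']
    exact (hD _).comp ih

lemma isConeMap_pullback (hC : ∀ t ω, IsConeMap (K ω) (K ((⇑T)^[t] ω)) (C t ω)) (t : ℕ) (ω : Ω) :
    IsConeMap (K ((⇑T.symm)^[t] ω)) (K ω) (C t ((⇑T.symm)^[t] ω)) := by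
  simpa only [iterate_apply_iterate_symm] using hC t ((⇑T.symm)^[t] ω)

lemma exists_cocycle_apply_eq_smul {α : Ω → ℝ} (hD : ∀ ω, IsConeMap (K ω) (K (T ω)) (D ω))
    (hC0 : ∀ ω, C 0 ω = id) (hCrec : ∀ t ω, C (t + 1) ω = D ((⇑T)^[t] ω) ∘ C t ω)
    (hα : ∀ ω, 0 < α ω) (hx : ∀ ω, x ω ∈ K ω) {ω : Ω}
    (heq : ∀ k, α ((⇑T)^[k] ω) • x (T ((⇑T)^[k] ω)) = D ((⇑T)^[k] ω) (x ((⇑T)^[k] ω))) (l : ℕ) :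
    ∃ β : ℝ, 0 < β ∧ C l ω (x ω) = β • x ((⇑T)^[l] ω) := by
  induction l with
  | zero => exact ⟨1, one_pos, by simp [hC0]⟩
  | succ l ih =>
    obtain ⟨β, hβ, h⟩ := ih
    refine ⟨β * α ((⇑T)^[l] ω), mul_pos hβ (hα _), ?_⟩
    rw [hCrec, Function.comp_apply, h, (hD _).map_smul β hβ _ (hx _), ← heq, smul_smul,
      Function.iterate_succ_apply']

variable (hpair : ∀ ω, IsUnitPair (K ω) (x ω) (φ ω))
  (hC : ∀ t ω, IsConeMap (K ω) (K ((⇑T)^[t] ω)) (C t ω))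
  (hadd : ∀ t l ω, C (t + l) ω = C l ((⇑T)^[t] ω) ∘ C t ω)

include hpair hC hadd

lemma monotone_pullbackRatio (ω : Ω) : Monotone fun t => pullbackRatio T K C x t ω := by
  refine monotone_nat_of_le_succ fun t => le_iInf₂ fun a ha => ?_
  have hshift : (⇑T)^[1] ((⇑T.symm)^[t + 1] ω) = (⇑T.symm)^[t] ω := by
    rw [Function.iterate_one, Function.iterate_succ_apply', T.apply_symm_apply]
  have h1 := hC 1 ((⇑T.symm)^[t + 1] ω)
  have hmem := h1.mapsTo ha.1
  rw [hshift] at hmem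
  have hne := h1.map_ne_zero (hpair _).solid ha.1 ha.2
  rw [add_comm t 1, hadd, add_comm 1 t, hshift]
  exact iInf₂_le _ ⟨hmem, hne⟩

lemma pullbackRatio_le_iterate {l : ℕ} {ω : Ω} {β : ℝ} (hβ : 0 < β)
    (heig : C l ω (x ω) = β • x ((⇑T)^[l] ω)) (t : ℕ) :
    pullbackRatio T K C x t ω ≤ pullbackRatio T K C x (t + l) ((⇑T)^[l] ω) := by
  refine le_iInf₂ fun a ha => ?_
  rw [Function.iterate_add_apply, iterate_symm_apply_iterate] at ha ⊢
  have ht := isConeMap_pullback hC t ω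
  rw [hadd, iterate_apply_iterate_symm]
  exact (iInf₂_le a ha).trans (ENNReal.ofReal_le_ofReal
    ((hC l ω).orderRatio_le_map (hpair _) (hpair _) hβ heig (ht.mapsTo ha.1)
      (ht.map_ne_zero (hpair _).solid ha.1 ha.2)))

lemma iSup_pullbackRatio_le_iterate {l : ℕ} {ω : Ω} {β : ℝ} (hβ : 0 < β)
    (heig : C l ω (x ω) = β • x ((⇑T)^[l] ω)) :
    ⨆ t, pullbackRatio T K C x t ω ≤ ⨆ t, pullbackRatio T K C x t ((⇑T)^[l] ω) :=
  iSup_le fun t => (pullbackRatio_le_iterate hpair hC hadd hβ heig t).trans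
    (le_iSup (fun t => pullbackRatio T K C x t ((⇑T)^[l] ω)) (t + l))

/-- If a strictly monotone iterate does not increase the limiting pullback ratio, then that
ratio is one. -/
lemma one_le_iSup_pullbackRatio [FiniteDimensional ℝ E] {l : ℕ} {ω : Ω} {β : ℝ} (hβ : 0 < β)
    (heig : C l ω (x ω) = β • x ((⇑T)^[l] ω))
    (hstrict : ConeStrictlyMonotoneOn (K ω) (K ((⇑T)^[l] ω)) (C l ω))
    (hinv : ⨆ t, pullbackRatio T K C x t ((⇑T)^[l] ω) ≤ ⨆ t, pullbackRatio T K C x t ω) :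
    1 ≤ ⨆ t, pullbackRatio T K C x t ω := by
  by_contra! hlt
  obtain ⟨u, -, hu, hutend⟩ := exists_seq_strictAnti_tendsto' hlt
  have hex : ∀ t, ∃ c ∈ {y ∈ K ω | φ ω y = 1},
      pullbackRatio T K C x t ω ≤ ENNReal.ofReal (orderRatio (K ω) (x ω) c) ∧
      ENNReal.ofReal (orderRatio (K ((⇑T)^[l] ω)) (x ((⇑T)^[l] ω)) (C l ω c)) ≤ u t := by
    intro t
    have h1 : pullbackRatio T K C x (t + l) ((⇑T)^[l] ω) < u t :=
      ((le_iSup (fun t => pullbackRatio T K C x t ((⇑T)^[l] ω)) (t + l)).trans hinv).trans_lt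
        (hu t).1
    simp only [pullbackRatio, iInf_lt_iff] at h1
    obtain ⟨a, ha, hau⟩ := h1
    rw [Function.iterate_add_apply, iterate_symm_apply_iterate] at ha hau
    rw [hadd, iterate_apply_iterate_symm] at hau
    have ht := isConeMap_pullback hC t ω
    have hb := ht.mapsTo ha.1
    have hpos := (hpair ω).apply_pos hb (ht.map_ne_zero (hpair _).solid ha.1 ha.2)
    have hinvpos := inv_pos.2 hpos
    refine ⟨_, ⟨(hpair ω).solid.smul_mem hinvpos.le hb, ?_⟩, ?_, ?_⟩
    · rw [map_smul, smul_eq_mul, inv_mul_cancel₀ hpos.ne']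
    · rw [(hpair ω).orderRatio_smul hinvpos]
      exact iInf₂_le a ha
    · rw [(hC l ω).map_smul _ hinvpos _ hb, (hpair _).orderRatio_smul hinvpos]
      exact hau.le
  choose c hc hc1 hc2 using hex
  obtain ⟨b, hb, ψ, hψ, hlim⟩ := (hpair ω).isCompact_slice.tendsto_subseq hc
  have hne : ∀ y ∈ {y ∈ K ω | φ ω y = 1}, y ∈ {a ∈ K ω | a ≠ 0} := by
    rintro y ⟨hy, hy1⟩
    refine ⟨hy, ?_⟩
    rintro rfl
    simp at hy1
  have hb' := hne b hb
  have hlim' : Tendsto (c ∘ ψ) atTop (𝓝[{a ∈ K ω | a ≠ 0}] b) :=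
    tendsto_nhdsWithin_iff.2 ⟨hlim, Eventually.of_forall fun n => hne _ (hc _)⟩
  have hlower : ⨆ t, pullbackRatio T K C x t ω ≤ ENNReal.ofReal (orderRatio (K ω) (x ω) b) := by
    refine le_of_tendsto_of_tendsto'
      ((tendsto_atTop_iSup (monotone_pullbackRatio hpair hC hadd ω)).comp hψ.tendsto_atTop)
      (ENNReal.tendsto_ofReal (((hpair ω).continuousAt_orderRatio hb'.1 hb'.2).tendsto.comp hlim))
      fun n => hc1 _
  have hupper : ENNReal.ofReal (orderRatio (K ((⇑T)^[l] ω)) (x ((⇑T)^[l] ω)) (C l ω b)) ≤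
      ⨆ t, pullbackRatio T K C x t ω := by
    refine le_of_tendsto_of_tendsto'
      (ENNReal.tendsto_ofReal
        (((hC l ω).continuousOn_orderRatio (hpair ω).solid (hpair _) b hb').tendsto.comp hlim'))
      (hutend.comp hψ.tendsto_atTop) fun n => hc2 _
  rcases (hC l ω).orderRatio_lt_map_or_eq_one hstrict (hpair ω) (hpair _) hβ heig hb'.1 hb'.2
    with h | h
  · have := (ENNReal.ofReal_le_ofReal_iff ((hpair ω).orderRatio_nonneg hb'.1 hb'.2)).1
      (hupper.trans hlower)
    exact this.not_gt h
  · rw [h, ENNReal.ofReal_one] at hupper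
    exact hupper.not_gt hlt

omit hadd in
lemma pullbackRatio_le_one (t : ℕ) (ω : Ω) : pullbackRatio T K C x t ω ≤ 1 := by
  have hp := hpair ((⇑T.symm)^[t] ω)
  have ht := isConeMap_pullback hC t ω
  refine (iInf₂_le _ ⟨hp.mem, hp.ne_zero⟩).trans (ENNReal.ofReal_le_one.2 ?_)
  exact (hpair ω).orderRatio_le_one (ht.mapsTo hp.mem) (ht.map_ne_zero hp.solid hp.mem hp.ne_zero)

/-- If the limiting pullback ratio is one, then the normalized pullback iterates converge
uniformly. -/
lemma exists_norm_normalized_pullback_sub_lt {ω : Ω} (h1 : 1 ≤ ⨆ t, pullbackRatio T K C x t ω)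
    {ε : ℝ} (hε : 0 < ε) :
    ∃ M : ℕ, ∀ t : ℕ, M ≤ t → ∀ a ∈ K ((⇑T.symm)^[t] ω), a ≠ 0 →
      ‖(φ ω (C t ((⇑T.symm)^[t] ω) a))⁻¹ • C t ((⇑T.symm)^[t] ω) a - x ω‖ < ε := by
  obtain ⟨c, hc, hcK⟩ := (hpair ω).exists_norm_normalized_sub_le
  have hlt : ENNReal.ofReal (1 - ε / c) < ⨆ t, pullbackRatio T K C x t ω := by
    refine lt_of_lt_of_le ?_ h1
    rw [ENNReal.ofReal_lt_one]
    have : 0 < ε / c := by positivity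
    linarith
  obtain ⟨M, hM⟩ := lt_iSup_iff.1 hlt
  refine ⟨M, fun t ht a ha ha0 => ?_⟩
  have hmap := isConeMap_pullback hC t ω
  have hb := hmap.mapsTo ha
  have hb0 := hmap.map_ne_zero (hpair _).solid ha ha0
  have h2 := (hM.trans_le (monotone_pullbackRatio hpair hC hadd ω ht)).trans_le
    (iInf₂_le a ⟨ha, ha0⟩)
  have h3 := (ENNReal.ofReal_lt_ofReal_iff'.1 h2).1
  refine (hcK _ hb hb0).trans_lt ?_
  rw [← lt_div_iff₀' hc]
  linarith

end Cocycle

section Measurability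

variable {Ω E : Type*} [MeasurableSpace Ω] [NormedAddCommGroup E] [NormedSpace ℝ E]
  [MeasurableSpace E] [BorelSpace E] [SecondCountableTopology E]
  {T : Ω ≃ Ω} {K : Ω → Set E} {D : Ω → E → E} {C : ℕ → Ω → E → E} {x : Ω → E}
  {φ : Ω → E →L[ℝ] ℝ}

lemma measurable_orderGauge (hpair : ∀ ω, IsUnitPair (K ω) (x ω) (φ ω))
    (hK : MeasurableSet {p : Ω × E | p.2 ∈ K p.1}) (hx : Measurable x) {b : Ω → E}
    (hb : Measurable b) : Measurable fun ω => orderGauge (K ω) (x ω) (b ω) := by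
  refine measurable_of_Iio fun c => ?_
  have : (fun ω => orderGauge (K ω) (x ω) (b ω)) ⁻¹' Set.Iio c =
      ⋃ q ∈ {q : ℚ | (q : ℝ) < c}, {ω | (q : ℝ) • x ω - b ω ∈ K ω} := by
    ext ω
    simp only [Set.mem_preimage, Set.mem_Iio, Set.mem_iUnion, Set.mem_ofPred_eq, exists_prop]
    constructor
    · intro h
      obtain ⟨q, hq1, hq2⟩ := exists_rat_btwn h
      exact ⟨q, hq2, (hpair ω).orderGauge_le_iff.1 hq1.le⟩
    · rintro ⟨q, hq, h⟩
      exact ((hpair ω).orderGauge_le_iff.2 h).trans_lt hq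
  rw [this]
  refine MeasurableSet.biUnion (Set.to_countable _) fun q _ => ?_
  exact (measurable_id.prodMk ((hx.const_smul (q : ℝ)).sub hb)) hK

lemma measurable_orderRatio (hpair : ∀ ω, IsUnitPair (K ω) (x ω) (φ ω))
    (hK : MeasurableSet {p : Ω × E | p.2 ∈ K p.1}) (hx : Measurable x) {b : Ω → E}
    (hb : Measurable b) : Measurable fun ω => orderRatio (K ω) (x ω) (b ω) :=
  (measurable_orderGauge hpair hK hx hb.neg).neg.div (measurable_orderGauge hpair hK hx hb)

omit [BorelSpace E] [SecondCountableTopology E] in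
lemma measurable_cocycle (hK : MeasurableSet {p : Ω × E | p.2 ∈ K p.1}) (hT : Measurable T)
    (hD : Measurable fun p : Ω × E => if p.2 ∈ K p.1 then D p.1 p.2 else 0)
    (hC : ∀ t ω, IsConeMap (K ω) (K ((⇑T)^[t] ω)) (C t ω)) (hC0 : ∀ ω, C 0 ω = id)
    (hCrec : ∀ t ω, C (t + 1) ω = D ((⇑T)^[t] ω) ∘ C t ω) (t : ℕ) :
    Measurable fun p : Ω × E => if p.2 ∈ K p.1 then C t p.1 p.2 else 0 := by
  induction t with
  | zero =>
    simp only [hC0, id]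
    exact Measurable.ite hK measurable_snd measurable_const
  | succ t ih =>
    have hcomp := hD.comp (((hT.iterate t).comp measurable_fst).prodMk ih)
    have hite : Measurable fun p : Ω × E => if p.2 ∈ K p.1 then _ else (0 : E) :=
      Measurable.ite hK hcomp measurable_const
    convert hite using 2 with p
    by_cases hp : p.2 ∈ K p.1
    · simp [hp, hCrec, (hC t p.1).mapsTo hp]
    · simp [hp]

omit [MeasurableSpace Ω] [MeasurableSpace E] [BorelSpace E] [SecondCountableTopology E] in
lemma pullbackRatio_eq_iInf_of_denseRange (hpair : ∀ ω, IsUnitPair (K ω) (x ω) (φ ω))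
    (hC : ∀ t ω, IsConeMap (K ω) (K ((⇑T)^[t] ω)) (C t ω)) {q : ℕ → E} (hq : DenseRange q)
    (t : ℕ) (ω : Ω) :
    pullbackRatio T K C x t ω = ⨅ n, if q n ∈ K ((⇑T.symm)^[t] ω) ∧ q n ≠ 0 then
      ENNReal.ofReal (orderRatio (K ω) (x ω)
        (if q n ∈ K ((⇑T.symm)^[t] ω) then C t ((⇑T.symm)^[t] ω) (q n) else 0)) else ⊤ := by
  apply le_antisymm
  · refine le_iInf fun n => ?_
    split_ifs with h1 h2
    · exact iInf₂_le_of_le (q n) h1 le_rfl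
    · exact absurd h1.1 h2
    · exact le_top
  · refine le_iInf₂ fun a ha => ?_
    have hsolid := (hpair ((⇑T.symm)^[t] ω)).solid
    have hcont := (isConeMap_pullback hC t ω).continuousOn_orderRatio hsolid (hpair ω) a ha
    have hcl : a ∈ closure ({a ∈ K ((⇑T.symm)^[t] ω) | a ≠ 0} ∩ Set.range q) := by
      have h1 := hsolid.mem_closure_inter_of_dense hq ha.1
      rw [mem_closure_iff_nhds] at h1 ⊢
      intro U hU
      obtain ⟨y, ⟨hyU, hy0⟩, hyK, hyq⟩ := h1 _ (Filter.inter_mem hU (isOpen_ne.mem_nhds ha.2))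
      exact ⟨y, hyU, ⟨hyK, hy0⟩, hyq⟩
    have := mem_closure_iff_nhdsWithin_neBot.1 hcl
    refine ge_of_tendsto (ENNReal.tendsto_ofReal
      (hcont.tendsto.mono_left (nhdsWithin_mono a (Set.inter_subset_left (t := Set.range q))))) ?_
    filter_upwards [self_mem_nhdsWithin] with y hy
    obtain ⟨⟨hyK, hy0⟩, n, rfl⟩ := hy
    refine (iInf_le _ n).trans ?_
    rw [if_pos ⟨hyK, hy0⟩, if_pos hyK]

lemma measurable_pullbackRatio (hpair : ∀ ω, IsUnitPair (K ω) (x ω) (φ ω))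
    (hC : ∀ t ω, IsConeMap (K ω) (K ((⇑T)^[t] ω)) (C t ω))
    (hK : MeasurableSet {p : Ω × E | p.2 ∈ K p.1}) (hx : Measurable x) (hT : Measurable T.symm)
    {t : ℕ} (hCt : Measurable fun p : Ω × E => if p.2 ∈ K p.1 then C t p.1 p.2 else 0) :
    Measurable (pullbackRatio T K C x t) := by
  rw [funext (pullbackRatio_eq_iInf_of_denseRange hpair hC (TopologicalSpace.denseRange_denseSeq E)
    t)]
  refine Measurable.iInf fun n => ?_
  have hm : Measurable fun ω => ((⇑T.symm)^[t] ω, TopologicalSpace.denseSeq E n) :=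
    (hT.iterate t).prodMk measurable_const
  refine Measurable.ite ((hm hK).inter (MeasurableSet.const _)) ?_ measurable_const
  exact (measurable_orderRatio hpair hK hx (hCt.comp hm)).ennreal_ofReal

end Measurability

/-- **Stochastic nonlinear Perron–Frobenius theorem, convergence part (Theorem 1(c)).**
For the eigenpair `(α, x)` of Theorem 1(a), the normalized cocycle iterates
`C(t, T⁻ᵗω) a / ⟨φ(ω), C(t, T⁻ᵗω) a⟩` converge to `x(ω)` as `t → ∞`,
uniformly in `0 ≠ a ∈ K₋ₜ(ω)`, almost surely. -/
theorem stochastic_perron_frobenius_convergence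
    {n : ℕ} {Ω : Type} [inst : MeasurableSpace Ω]
    [MeasurableSpace (EuclideanSpace ℝ (Fin n) →L[ℝ] ℝ)]
    [BorelSpace (EuclideanSpace ℝ (Fin n) →L[ℝ] ℝ)]
    (P : Measure Ω) [IsProbabilityMeasure P] (hPcomplete : P.IsComplete)
    -- `T` is an automorphism of the probability space
    (T : Ω ≃ Ω) (hT : Measurable T) (hTinv : Measurable T.symm)
    (hTP : MeasurePreserving T P P)
    -- the filtration `(ℱ_t)`, invariant under `T` and containing the null sets
    (F : ℤ → MeasurableSpace Ω) (hFle : ∀ t, F t ≤ inst) (hFmono : Monotone F)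
    (hFshift : ∀ t, F (t + 1) = (F t).comap T)
    (hFnull : ∀ t, ∀ N : Set Ω, P N = 0 → MeasurableSet[F t] N)
    -- the random solid cone `K(ω)`, `ℱ₀`-measurable
    (K : Ω → Set (EuclideanSpace ℝ (Fin n)))
    (hKsolid : ∀ ω, IsSolidCone (K ω))
    (hKgraph : MeasurableSet[(F 0).prod
        (inferInstance : MeasurableSpace (EuclideanSpace ℝ (Fin n)))]
      {p : Ω × EuclideanSpace ℝ (Fin n) | p.2 ∈ K p.1})
    -- the random mapping `D(ω, ·) : K₀(ω) → K₁(ω)`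
    (D : Ω → EuclideanSpace ℝ (Fin n) → EuclideanSpace ℝ (Fin n))
    (hDmaps : ∀ ω, ∀ x ∈ K ω, D ω x ∈ K (T ω))
    -- (D1): continuity in `x` and joint `ℱ₁ × 𝒱`-measurability of the extension `D̄`
    (hD1cont : ∀ ω, ContinuousOn (D ω) (K ω))
    (hD1meas : @Measurable (Ω × EuclideanSpace ℝ (Fin n)) (EuclideanSpace ℝ (Fin n) ⊕ Unit)
      ((F 1).prod inferInstance) inferInstance
      (fun p => if p.2 ∈ K p.1 then Sum.inl (D p.1 p.2) else Sum.inr ()))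
    -- (D2): positive homogeneity of degree one
    (hD2 : ∀ ω, ∀ l : ℝ, 0 < l → ∀ x ∈ K ω, D ω (l • x) = l • D ω x)
    -- (D3): complete monotonicity
    (hD3 : ∀ ω, CompletelyMonotoneOn (K ω) (K (T ω)) (D ω))
    -- the cocycle `C(t, ω) = D_t(ω) ∘ … ∘ D₁(ω)`
    (C : ℕ → Ω → EuclideanSpace ℝ (Fin n) → EuclideanSpace ℝ (Fin n))
    (hC0 : ∀ ω, C 0 ω = id)
    (hCrec : ∀ t ω, C (t + 1) ω = D ((⇑T)^[t] ω) ∘ C t ω)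
    -- (C): for a.e. `ω` some `C(l_ω, ω)` is strictly monotone
    (hCstrict : ∀ᵐ ω ∂P, ∃ l : ℕ, 0 < l ∧
      ConeStrictlyMonotoneOn (K ω) (K ((⇑T)^[l] ω)) (C l ω))
    -- the `ℱ₀`-measurable functional `φ(ω)` in the interior of the dual cone
    (φ : Ω → (EuclideanSpace ℝ (Fin n) →L[ℝ] ℝ))
    (hφmeas : Measurable[F 0] φ)
    (hφint : ∀ ω, φ ω ∈ interior (dualCone (K ω)))
    (x : Ω → EuclideanSpace ℝ (Fin n)) (α : Ω → ℝ)
    (hxmeas : Measurable[F 0] x) (hαmeas : Measurable[F 1] α)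
    (hpt : ∀ ω, 0 < α ω ∧ x ω ∈ interior (K ω) ∧ φ ω (x ω) = 1)
    (heq : ∀ᵐ ω ∂P, α ω • x (T ω) = D ω (x ω)) :
    ∀ᵐ ω ∂P, ∀ ε : ℝ, 0 < ε → ∃ M : ℕ, ∀ t : ℕ, M ≤ t →
      ∀ a ∈ K ((⇑T.symm)^[t] ω), a ≠ 0 →
        ‖(φ ω (C t ((⇑T.symm)^[t] ω) a))⁻¹ • C t ((⇑T.symm)^[t] ω) a - x ω‖ < ε := by
  have hD : ∀ ω, IsConeMap (K ω) (K (T ω)) (D ω) := fun ω =>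
    ⟨hDmaps ω, hD1cont ω, hD2 ω, hD3 ω⟩
  have hC := isConeMap_cocycle hD hC0 hCrec
  have hadd := cocycle_add hC0 hCrec
  have hpair : ∀ ω, IsUnitPair (K ω) (x ω) (φ ω) := fun ω =>
    ⟨hKsolid ω, (hpt ω).2.1, hφint ω, (hpt ω).2.2⟩
  have hprod : ∀ t, (F t).prod (inferInstance : MeasurableSpace (EuclideanSpace ℝ (Fin n))) ≤
      inst.prod inferInstance := fun t =>
    sup_le_sup (MeasurableSpace.comap_mono (hFle t)) le_rfl
  have hKm : MeasurableSet {p : Ω × EuclideanSpace ℝ (Fin n) | p.2 ∈ K p.1} :=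
    hprod 0 _ hKgraph
  have hx : Measurable x := hxmeas.mono (hFle 0) le_rfl
  have hDm : Measurable fun p : Ω × EuclideanSpace ℝ (Fin n) =>
      if p.2 ∈ K p.1 then D p.1 p.2 else 0 := by
    have h1 := hD1meas.mono (hprod 1) le_rfl
    have h2 : Measurable (Sum.elim id fun _ => 0 :
        EuclideanSpace ℝ (Fin n) ⊕ Unit → EuclideanSpace ℝ (Fin n)) :=
      measurable_id.sumElim measurable_const
    have h3 := h2.comp h1
    simpa only [Function.comp_def, apply_ite (Sum.elim id _), Sum.elim_inl, Sum.elim_inr, id]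
      using h3
  set H : Ω → ℝ≥0∞ := fun ω => ⨆ t, pullbackRatio T K C x t ω
  have hHm : Measurable H := Measurable.iSup fun t =>
    measurable_pullbackRatio hpair hC hKm hx hTinv (measurable_cocycle hKm hT hDm hC hC0 hCrec t)
  have hall : ∀ {p : Ω → Prop}, (∀ᵐ ω ∂P, p ω) → ∀ᵐ ω ∂P, ∀ k, p ((⇑T)^[k] ω) := fun hp =>
    ae_all_iff.2 fun k => (hTP.iterate k).quasiMeasurePreserving.ae hp
  have heig : ∀ᵐ ω ∂P, ∀ l, ∃ β : ℝ, 0 < β ∧ C l ω (x ω) = β • x ((⇑T)^[l] ω) := by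
    filter_upwards [hall heq] with ω hω
    exact exists_cocycle_apply_eq_smul hD hC0 hCrec (fun ω => (hpt ω).1)
      (fun ω => (hpair ω).mem) hω
  have hle : H ≤ᵐ[P] H ∘ T := by
    filter_upwards [heig] with ω hω
    obtain ⟨β, hβ, h⟩ := hω 1
    have hHω := iSup_pullbackRatio_le_iterate hpair hC hadd hβ h
    rwa [Function.iterate_one] at hHω
  have hfin : ∫⁻ ω, H ω ∂P ≠ ∞ := by
    refine ne_top_of_le_ne_top ENNReal.one_ne_top ?_
    calc ∫⁻ ω, H ω ∂P ≤ ∫⁻ _, 1 ∂P :=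
          lintegral_mono fun ω => iSup_le fun t => pullbackRatio_le_one hpair hC t ω
      _ = 1 := by simp
  have hinv : H =ᵐ[P] H ∘ T :=
    ae_eq_of_ae_le_of_lintegral_le hle hfin (hHm.comp hT).aemeasurable
      (hTP.lintegral_comp hHm).le
  filter_upwards [heig, hall hinv, hCstrict] with ω hω hHinv hstrict ε hε
  obtain ⟨l, -, hl⟩ := hstrict
  obtain ⟨β, hβ, hβl⟩ := hω l
  have hHl : ∀ k, H ((⇑T)^[k] ω) = H ω := by
    intro k
    induction k with
    | zero => rfl
    | succ k ih =>
      rw [Function.iterate_succ_apply', ← ih]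
      exact (hHinv k).symm
  exact exists_norm_normalized_pullback_sub_lt hpair hC hadd
    (one_le_iSup_pullbackRatio hpair hC hadd hβ hβl hl (hHl l).le) hε
end
end

section
/- If f : K → L is strictly monotone and homogeneous of degree 1, then the normalized map g(x) = f(x)/⟨φ₂, f(x)⟩ maps Y₁ into Y₂ and is strictly non-expansive: d₂(g(x), g(y)) < d₁(x, y) for all x, y ∈ Y₁ with x ≠ y. -/
open MeasureTheory Filter Topology
open scoped ENNReal Classical

noncomputable section

/-- The set `{β > 0 : x ≤_K β y}`. -/
def hilbertMSet {E : Type*} [NormedAddCommGroup E] [NormedSpace ℝ E] (K : Set E) (x y : E) :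
    Set ℝ := {β : ℝ | 0 < β ∧ coneLE K x (β • y)}

/-- The set `{α > 0 : α y ≤_K x}`. -/
def hilbertmSet {E : Type*} [NormedAddCommGroup E] [NormedSpace ℝ E] (K : Set E) (x y : E) :
    Set ℝ := {α : ℝ | 0 < α ∧ coneLE K (α • y) x}

/-- `M(x/y) = inf {β > 0 : x ≤_K β y}`. -/
def hilbertM {E : Type*} [NormedAddCommGroup E] [NormedSpace ℝ E] (K : Set E) (x y : E) : ℝ :=
  sInf (hilbertMSet K x y)

/-- `m(x/y) = sup {α > 0 : α y ≤_K x}`. -/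
def hilbertm {E : Type*} [NormedAddCommGroup E] [NormedSpace ℝ E] (K : Set E) (x y : E) : ℝ :=
  sSup (hilbertmSet K x y)

/-- The Hilbert–Birkhoff metric `d(x,y) = log (M(x/y) / m(x/y))`. -/
def hilbertDist {E : Type*} [NormedAddCommGroup E] [NormedSpace ℝ E] (K : Set E) (x y : E) : ℝ :=
  Real.log (hilbertM K x y / hilbertm K x y)

section ConeLemmas

variable {E : Type*} [NormedAddCommGroup E] [NormedSpace ℝ E] {K : Set E}

lemma IsCone.smul_mem (hK : IsCone K) {x : E} (hx : x ∈ K) {a : ℝ} (ha : 0 ≤ a) : a • x ∈ K := by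
  simpa using hK x hx x hx a 0 ha le_rfl

lemma exists_pos_sub_smul_mem_of_mem_interior {x : E} (hx : x ∈ interior K) (w : E) :
    ∃ ε : ℝ, 0 < ε ∧ x - ε • w ∈ K := by
  have hcont : Continuous fun ε : ℝ => x - ε • w := by fun_prop
  have hlim : Tendsto (fun ε : ℝ => x - ε • w) (𝓝 0) (𝓝 x) := by
    simpa using hcont.tendsto 0
  have hmem : ∀ᶠ ε : ℝ in 𝓝[>] 0, x - ε • w ∈ K :=
    (hlim.mono_left nhdsWithin_le_nhds).eventually (mem_interior_iff_mem_nhds.mp hx)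
  obtain ⟨ε, hε, hpos⟩ := (hmem.and self_mem_nhdsWithin).exists
  exact ⟨ε, hpos, hε⟩

lemma IsSolidCone.eq_zero_of_neg_mem (hK : IsSolidCone K) {x : E} (hx : x ∈ K) (hx' : -x ∈ K) :
    x = 0 := by
  have : x ∈ K ∩ -K := ⟨hx, hx'⟩
  rwa [hK.2.2.1] at this

lemma IsSolidCone.zero_mem_s4 (hK : IsSolidCone K) : (0 : E) ∈ K := by
  have : (0 : E) ∈ K ∩ -K := by rw [hK.2.2.1]; rfl
  exact this.1

lemma IsSolidCone.ne_zero_of_mem_interior [Nontrivial E] (hK : IsSolidCone K) {x : E}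
    (hx : x ∈ interior K) : x ≠ 0 := by
  rintro rfl
  obtain ⟨w, hw⟩ := exists_ne (0 : E)
  obtain ⟨ε, hε, h⟩ := exists_pos_sub_smul_mem_of_mem_interior hx w
  obtain ⟨δ, hδ, h'⟩ := exists_pos_sub_smul_mem_of_mem_interior hx (-w)
  refine hw (hK.eq_zero_of_neg_mem ?_ ?_)
  · simpa [smul_smul, hδ.ne'] using hK.1.smul_mem h' (inv_nonneg.mpr hδ.le)
  · simpa [smul_smul, hε.ne'] using hK.1.smul_mem h (inv_nonneg.mpr hε.le)

lemma pos_of_mem_interior_dualCone {φ : E →L[ℝ] ℝ} (hφ : φ ∈ interior (dualCone K)) {x : E}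
    (hx : x ∈ K) (hx0 : x ≠ 0) : 0 < φ x := by
  obtain ⟨ψ, -, hψ⟩ := exists_dual_vector ℝ x (norm_ne_zero_iff.mpr hx0)
  obtain ⟨ε, hε, h⟩ := exists_pos_sub_smul_mem_of_mem_interior hφ ψ
  have h1 := h x hx
  have h2 : ψ x = ‖x‖ := by simpa using hψ
  have h3 : 0 < ε * ‖x‖ := mul_pos hε (norm_pos_iff.mpr hx0)
  simp only [sub_apply, smul_apply, smul_eq_mul, h2] at h1
  linarith

variable {φ : E →L[ℝ] ℝ} {x y : E}

lemma one_le_of_mem_hilbertMSet (hφ : φ ∈ dualCone K) (hx : φ x = 1) (hy : φ y = 1) {β : ℝ}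
    (hβ : β ∈ hilbertMSet K x y) : 1 ≤ β := by
  have h := hφ _ hβ.2
  simp only [map_sub, map_smul, hx, hy, smul_eq_mul] at h
  linarith

lemma le_one_of_mem_hilbertmSet (hφ : φ ∈ dualCone K) (hx : φ x = 1) (hy : φ y = 1) {α : ℝ}
    (hα : α ∈ hilbertmSet K x y) : α ≤ 1 := by
  have h := hφ _ hα.2
  simp only [map_sub, map_smul, hx, hy, smul_eq_mul] at h
  linarith

lemma hilbertMSet_bddBelow : BddBelow (hilbertMSet K x y) := ⟨0, fun _ hβ => hβ.1.le⟩

lemma hilbertmSet_bddAbove (hφ : φ ∈ dualCone K) (hx : φ x = 1) (hy : φ y = 1) :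
    BddAbove (hilbertmSet K x y) := ⟨1, fun _ hα => le_one_of_mem_hilbertmSet hφ hx hy hα⟩

lemma IsCone.hilbertMSet_nonempty (hK : IsCone K) (hy : y ∈ interior K) :
    (hilbertMSet K x y).Nonempty := by
  obtain ⟨ε, hε, h⟩ := exists_pos_sub_smul_mem_of_mem_interior hy x
  refine ⟨ε⁻¹, inv_pos.mpr hε, ?_⟩
  simpa [coneLE, smul_sub, smul_smul, hε.ne'] using hK.smul_mem h (inv_nonneg.mpr hε.le)

lemma hilbertmSet_nonempty (hx : x ∈ interior K) : (hilbertmSet K x y).Nonempty :=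
  exists_pos_sub_smul_mem_of_mem_interior hx y

lemma coneLE_hilbertM_smul (hK : IsClosed K) (hne : (hilbertMSet K x y).Nonempty) :
    coneLE K x (hilbertM K x y • y) := by
  have hcl : IsClosed {β : ℝ | β • y - x ∈ K} := hK.preimage (by fun_prop)
  exact closure_minimal (fun _ hβ => hβ.2) hcl (csInf_mem_closure hne hilbertMSet_bddBelow)

lemma hilbertm_smul_coneLE (hK : IsClosed K) (hne : (hilbertmSet K x y).Nonempty)
    (hbdd : BddAbove (hilbertmSet K x y)) : coneLE K (hilbertm K x y • y) x := by
  have hcl : IsClosed {α : ℝ | x - α • y ∈ K} := hK.preimage (by fun_prop)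
  exact closure_minimal (fun _ hα => hα.2) hcl (csSup_mem_closure hne hbdd)

lemma coneLE_smul_inv_smul (hK : IsCone K) {a b β : ℝ} (ha : 0 < a) (hb : 0 < b)
    (h : coneLE K x (β • y)) : coneLE K (a⁻¹ • x) ((β * (b / a)) • b⁻¹ • y) := by
  have h' := hK.smul_mem h (inv_nonneg.mpr ha.le)
  have e : β * (b / a) * b⁻¹ = a⁻¹ * β := by field_simp
  rwa [smul_sub, smul_smul, ← e, ← smul_smul] at h'

lemma smul_inv_smul_coneLE (hK : IsCone K) {a b α : ℝ} (ha : 0 < a) (hb : 0 < b)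
    (h : coneLE K (α • y) x) : coneLE K ((α * (b / a)) • b⁻¹ • y) (a⁻¹ • x) := by
  have h' := hK.smul_mem h (inv_nonneg.mpr ha.le)
  have e : α * (b / a) * b⁻¹ = a⁻¹ * α := by field_simp
  rwa [smul_sub, smul_smul, ← e, ← smul_smul] at h'

lemma hilbertM_inv_smul_lt (hK : IsCone K) (hφ : φ ∈ dualCone K) (hx : 0 < φ x) (hy : 0 < φ y)
    {β : ℝ} (h : coneLT K x (β • y)) :
    1 ≤ hilbertM K ((φ x)⁻¹ • x) ((φ y)⁻¹ • y) ∧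
      hilbertM K ((φ x)⁻¹ • x) ((φ y)⁻¹ • y) < β * (φ y / φ x) := by
  obtain ⟨ε, hε, hmem⟩ := exists_pos_sub_smul_mem_of_mem_interior h y
  have hle : coneLE K x ((β - ε) • y) := by
    simpa only [coneLE, sub_smul, sub_right_comm] using hmem
  have hpos : 0 < β - ε := by
    have h0 := hφ _ hle
    simp only [map_sub, map_smul, smul_eq_mul] at h0
    exact pos_of_mul_pos_left (by linarith) hy.le
  have hmemM : (β - ε) * (φ y / φ x) ∈ hilbertMSet K ((φ x)⁻¹ • x) ((φ y)⁻¹ • y) :=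
    ⟨by positivity, coneLE_smul_inv_smul hK hx hy hle⟩
  refine ⟨le_csInf ⟨_, hmemM⟩ fun _ hb =>
    one_le_of_mem_hilbertMSet hφ (by simp [hx.ne']) (by simp [hy.ne']) hb, ?_⟩
  refine (csInf_le hilbertMSet_bddBelow hmemM).trans_lt ?_
  exact mul_lt_mul_of_pos_right (by linarith) (by positivity)

lemma lt_hilbertm_inv_smul (hK : IsCone K) (hφ : φ ∈ dualCone K) (hx : 0 < φ x) (hy : 0 < φ y)
    {α : ℝ} (hα : 0 < α) (h : coneLT K (α • y) x) :
    α * (φ y / φ x) < hilbertm K ((φ x)⁻¹ • x) ((φ y)⁻¹ • y) := by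
  obtain ⟨ε, hε, hmem⟩ := exists_pos_sub_smul_mem_of_mem_interior h y
  have hle : coneLE K ((α + ε) • y) x := by
    simpa only [coneLE, add_smul, sub_sub] using hmem
  have hmemm : (α + ε) * (φ y / φ x) ∈ hilbertmSet K ((φ x)⁻¹ • x) ((φ y)⁻¹ • y) :=
    ⟨by positivity, smul_inv_smul_coneLE hK hx hy hle⟩
  refine lt_of_lt_of_le ?_ (le_csSup (hilbertmSet_bddAbove hφ (by simp [hx.ne'])
    (by simp [hy.ne'])) hmemm)
  exact mul_lt_mul_of_pos_right (by linarith) (by positivity)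

lemma IsSolidCone.interior_smul_mem (hK : IsSolidCone K) (hx : x ∈ interior K) {a : ℝ}
    (ha : 0 < a) : a • x ∈ interior K := by
  refine interior_maximal ?_ (isOpen_interior.smul₀ ha.ne') (Set.smul_mem_smul_set hx)
  rintro _ ⟨z, hz, rfl⟩
  exact hK.1.smul_mem (interior_subset hz) ha.le

end ConeLemmas

/-- **Theorem 2, strict non-expansiveness part.** If `f : K → L` is strictly monotone
and homogeneous of degree one, then the normalized map `g x = f x / ⟨φ₂, f x⟩` maps
`Y₁ = Σ_{φ₁}^K ∩ K°` into `Y₂ = Σ_{φ₂}^L ∩ L°` and is strictly non-expansive: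
`d₂(g x, g y) < d₁(x, y)` for all `x ≠ y` in `Y₁`. -/
theorem normalized_strictly_monotone_strictly_nonexpansive
    {E : Type*} [NormedAddCommGroup E] [NormedSpace ℝ E] [FiniteDimensional ℝ E]
    (K L : Set E) (hK : IsSolidCone K) (hL : IsSolidCone L)
    (φ₁ φ₂ : E →L[ℝ] ℝ)
    (hφ₁ : φ₁ ∈ interior (dualCone K)) (hφ₂ : φ₂ ∈ interior (dualCone L))
    (f : E → E) (hfmaps : ∀ x ∈ K, f x ∈ L)
    (hfstrict : ConeStrictlyMonotoneOn K L f)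
    (hfhom : ∀ l : ℝ, 0 < l → ∀ x ∈ K, f (l • x) = l • f x) :
    (∀ x, x ∈ interior K → φ₁ x = 1 →
      (φ₂ (f x))⁻¹ • f x ∈ interior L ∧ φ₂ ((φ₂ (f x))⁻¹ • f x) = 1) ∧
    (∀ x, x ∈ interior K → φ₁ x = 1 → ∀ y, y ∈ interior K → φ₁ y = 1 → x ≠ y →
      hilbertDist L ((φ₂ (f x))⁻¹ • f x) ((φ₂ (f y))⁻¹ • f y) < hilbertDist K x y) := by
  have hφ₁' := interior_subset hφ₁
  have hφ₂' := interior_subset hφ₂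
  have hf0 : f 0 = 0 := by
    have h := hfhom 2 two_pos 0 hK.zero_mem_s4
    rwa [smul_zero, two_smul, left_eq_add] at h
  have hf_interior : ∀ x, x ∈ interior K → φ₁ x = 1 → f x ∈ interior L ∧ 0 < φ₂ (f x) := by
    intro x hx hx1
    have hx0 : x ≠ 0 := by rintro rfl; simp at hx1
    have : Nontrivial E := ⟨x, 0, hx0⟩
    have h := hfstrict 0 hK.zero_mem_s4 x (interior_subset hx)
      ⟨by simpa [coneLE] using interior_subset hx, hx0.symm⟩
    rw [coneLT, hf0, sub_zero] at h
    exact ⟨h, pos_of_mem_interior_dualCone hφ₂ (interior_subset h) (hL.ne_zero_of_mem_interior h)⟩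
  refine ⟨fun x hx hx1 => ?_, fun x hx hx1 y hy hy1 hxy => ?_⟩
  · obtain ⟨h, hpos⟩ := hf_interior x hx hx1
    exact ⟨hL.interior_smul_mem h (inv_pos.mpr hpos), by simp [hpos.ne']⟩
  obtain ⟨-, ha⟩ := hf_interior x hx hx1
  obtain ⟨-, hb⟩ := hf_interior y hy hy1
  have hxK := interior_subset hx
  have hyK := interior_subset hy
  have hMne := hK.1.hilbertMSet_nonempty (x := x) hy
  have hmne := hilbertmSet_nonempty (y := y) hx
  have hmb := hilbertmSet_bddAbove hφ₁' hx1 hy1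
  have hMle := coneLE_hilbertM_smul hK.2.1 hMne
  have hmle := hilbertm_smul_coneLE hK.2.1 hmne hmb
  have hMpos : 0 < hilbertM K x y :=
    one_pos.trans_le (le_csInf hMne fun _ => one_le_of_mem_hilbertMSet hφ₁' hx1 hy1)
  have hmpos : 0 < hilbertm K x y := hmne.some_mem.1.trans_le (le_csSup hmb hmne.some_mem)
  have hne : ∀ c : ℝ, x ≠ c • y := by
    rintro c rfl
    have hc : c = 1 := by simpa [hy1] using hx1
    simp [hc] at hxy
  have hMlt := hfstrict x hxK _ (hK.1.smul_mem hyK hMpos.le) ⟨hMle, hne _⟩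
  have hmlt := hfstrict _ (hK.1.smul_mem hyK hmpos.le) x hxK ⟨hmle, (hne _).symm⟩
  rw [hfhom _ hMpos y hyK] at hMlt
  rw [hfhom _ hmpos y hyK] at hmlt
  obtain ⟨hM1, hM2⟩ := hilbertM_inv_smul_lt hL.1 hφ₂' ha hb hMlt
  have hm2 := lt_hilbertm_inv_smul hL.1 hφ₂' ha hb hmpos hmlt
  have hc : 0 < φ₂ (f y) / φ₂ (f x) := div_pos hb ha
  have hm3 := (mul_pos hmpos hc).trans hm2
  refine Real.log_lt_log (div_pos (by linarith) hm3) ?_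
  rw [← mul_div_mul_right (hilbertM K x y) _ hc.ne']
  exact div_lt_div₀ hM2 hm2.le (by positivity) (mul_pos hmpos hc)
end
end
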